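/- Let M be an irreducible affine algebraic monoid with unit group G and let H ⊆ G be a subgroup, closed in M. Then H is observable in M if and only if there exist a finite-dimensional rational right M-module V and a vector v ∈ V such that the stabilizer G_v = {g ∈ G : v·g = v} equals H. Moreover, in that case G_v = M_v = {x ∈ M : v·x = v} is closed in M. -/

import Mathlib

open MvPolynomial

namespace AlgebraicMonoid

variable (k : Type) [Field k] [IsAlgClosed k] (n : ℕ)

/-- `n × n` matrices over `k`: the ambient affine space for linear algebraic monoids. -/
abbrev Mat := Matrix (Fin n) (Fin n) k

/-- Polynomial functions on the space of `n × n` matrices. -/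
abbrev MPoly := MvPolynomial (Fin n × Fin n) k

variable {k n}

/-- Evaluation of a polynomial at a matrix. -/
noncomputable def mEval (x : Mat k n) (p : MPoly k n) : k :=
  eval (fun ij => x ij.1 ij.2) p

/-- The (regular function induced by) `p` vanishes identically on `X`. -/
def VanishesOn (X : Set (Mat k n)) (p : MPoly k n) : Prop :=
  ∀ x ∈ X, mEval x p = 0

/-- Zariski closed subsets of matrix space. -/
def ZClosed (X : Set (Mat k n)) : Prop :=
  ∃ S : Set (MPoly k n), X = {x | ∀ p ∈ S, mEval x p = 0}

/-- An affine (linear) algebraic monoid, realized as a Zariski closed submonoid of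
matrix space (every affine algebraic monoid admits such a closed embedding). -/
structure IsAlgMonoid (M : Set (Mat k n)) : Prop where
  zclosed : ZClosed M
  one_mem : (1 : Mat k n) ∈ M
  mul_mem : ∀ a ∈ M, ∀ b ∈ M, a * b ∈ M

/-- The unit group `G(M)` of the monoid `M`. -/
def unitGroup (M : Set (Mat k n)) : Set (Mat k n) :=
  {g | g ∈ M ∧ ∃ h ∈ M, g * h = 1 ∧ h * g = 1}

/-- `H` is an (abstract) subgroup of `G`. -/
def IsSubgroupOf (H G : Set (Mat k n)) : Prop :=
  H ⊆ G ∧ (1 : Mat k n) ∈ H ∧ (∀ a ∈ H, ∀ b ∈ H, a * b ∈ H) ∧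
    ∀ a ∈ H, ∃ b ∈ H, a * b = 1 ∧ b * a = 1

/-- `Y` is closed in `X` (for the Zariski topology). -/
def IsClosedIn (Y X : Set (Mat k n)) : Prop :=
  Y ⊆ X ∧ ∃ C : Set (Mat k n), ZClosed C ∧ Y = C ∩ X

/-- `X` is irreducible: nonempty, and its vanishing ideal is prime. -/
def IrreducibleSet (X : Set (Mat k n)) : Prop :=
  X.Nonempty ∧ ∀ p q : MPoly k n, VanishesOn X (p * q) → VanishesOn X p ∨ VanishesOn X q

/-- The action of `H` on `M` by left multiplication is observable: every nonzero
`H`-stable ideal of `k[M]` (presented as an ideal of the polynomial ring containing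
the vanishing ideal of `M`) contains a nonzero `H`-invariant function.
Here `H` acts on `k[M]` by `(f · h)(m) = f (h * m)`. -/
def LeftObservable (H M : Set (Mat k n)) : Prop :=
  ∀ J : Ideal (MPoly k n),
    (∀ p : MPoly k n, VanishesOn M p → p ∈ J) →
    (∀ p ∈ J, ∀ h ∈ H, ∃ p' ∈ J, ∀ m ∈ M, mEval m p' = mEval (h * m) p) →
    (∃ p ∈ J, ¬ VanishesOn M p) →
    ∃ p ∈ J, (¬ VanishesOn M p) ∧ ∀ h ∈ H, ∀ m ∈ M, mEval (h * m) p = mEval m p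

/-- `χ` defines a character of (the monoid) `X`, i.e. a regular multiplicative map to `k`. -/
structure IsCharacterOn (X : Set (Mat k n)) (χ : MPoly k n) : Prop where
  map_one : mEval 1 χ = 1
  map_mul : ∀ a ∈ X, ∀ b ∈ X, mEval (a * b) χ = mEval a χ * mEval b χ

/-- The character `χ` of `H` is extendible to `M`: there is a nonzero
`H`-semiinvariant `f ∈ k[M]` of weight `χ`, i.e. `f(h m) = χ(h) f(m)`. -/
def Extendible (M H : Set (Mat k n)) (χ : MPoly k n) : Prop :=
  ∃ f : MPoly k n, (¬ VanishesOn M f) ∧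
    ∀ h ∈ H, ∀ m ∈ M, mEval (h * m) f = mEval h χ * mEval m f

/-- The matrix of regular functions `P` evaluated at `x`: a rational representation. -/
noncomputable def repApply {d : ℕ} (P : Matrix (Fin d) (Fin d) (MPoly k n)) (x : Mat k n) :
    Matrix (Fin d) (Fin d) k :=
  Matrix.of fun i j => mEval x (P i j)

/-- `P` defines a (finite dimensional rational) right `M`-module structure on `k^d`,
the action being `v · x = v ᵥ* (P x)`. -/
def IsRightRep {d : ℕ} (M : Set (Mat k n)) (P : Matrix (Fin d) (Fin d) (MPoly k n)) : Prop :=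
  repApply P 1 = 1 ∧ ∀ a ∈ M, ∀ b ∈ M, repApply P (a * b) = repApply P a * repApply P b

end AlgebraicMonoid

namespace AlgebraicMonoid

variable {k : Type} [Field k] {n : ℕ}

theorem mEval_eq_aeval (x : Mat k n) (p : MPoly k n) :
    mEval x p = aeval (fun ij : Fin n × Fin n => x ij.1 ij.2) p := by
  simp [mEval, aeval_eq_eval]

theorem mEval_sub (x : Mat k n) (p q : MPoly k n) : mEval x (p - q) = mEval x p - mEval x q := by
  simp [mEval]

theorem mEval_add (x : Mat k n) (p q : MPoly k n) : mEval x (p + q) = mEval x p + mEval x q := by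
  simp [mEval]

theorem mEval_mul (x : Mat k n) (p q : MPoly k n) : mEval x (p * q) = mEval x p * mEval x q := by
  simp [mEval]

theorem mEval_C (x : Mat k n) (c : k) : mEval x (C c) = c := by
  simp [mEval]

theorem mEval_sum {ι : Type*} (s : Finset ι) (x : Mat k n) (p : ι → MPoly k n) :
    mEval x (∑ i ∈ s, p i) = ∑ i ∈ s, mEval x (p i) := by
  simp [mEval]

/-- The determinant as a polynomial function on matrices. -/
noncomputable def detPoly (k : Type) [Field k] (n : ℕ) : MPoly k n :=
  (Matrix.mvPolynomialX (Fin n) (Fin n) k).det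

theorem mEval_detPoly (x : Mat k n) : mEval x (detPoly k n) = x.det := by
  rw [mEval_eq_aeval, detPoly, AlgHom.map_det, Matrix.mvPolynomialX_mapMatrix_aeval]

/-- The determinant of a matrix of regular functions is regular. -/
theorem mEval_det {ι : Type*} [Fintype ι] [DecidableEq ι] (B : Matrix ι ι (MPoly k n))
    (x : Mat k n) : mEval x B.det = (B.map (mEval x)).det :=
  RingHom.map_det (eval fun ij : Fin n × Fin n => x ij.1 ij.2) B

/-- The vanishing ideal of a set of matrices. -/
def idealOf (X : Set (Mat k n)) : Ideal (MPoly k n) where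
  carrier := {p | VanishesOn X p}
  zero_mem' := fun x _ => by simp [mEval]
  add_mem' := fun {a b} ha hb x hx => by simp [mEval_add, ha x hx, hb x hx]
  smul_mem' := fun c a ha x hx => by simp [mEval_mul, ha x hx]

theorem ZClosed.mem_of_vanishing {X : Set (Mat k n)} (hX : ZClosed X) {x : Mat k n}
    (h : ∀ p ∈ idealOf X, mEval x p = 0) : x ∈ X := by
  obtain ⟨S, rfl⟩ := hX
  exact fun p hp => h p fun y hy => hy p hp

/-- Substituting a matrix of polynomials into a polynomial. -/
theorem mEval_aeval (Q : Matrix (Fin n) (Fin n) (MPoly k n)) (p : MPoly k n) (x : Mat k n) :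
    mEval x (aeval (fun ij : Fin n × Fin n => Q ij.1 ij.2) p) = mEval (Q.map (mEval x)) p := by
  induction p using MvPolynomial.induction_on with
  | C a => simp [mEval]
  | add p q hp hq => simp only [map_add, mEval_add, hp, hq]
  | mul_X p i hp =>
    simp only [map_mul, mEval_mul, hp, aeval_X]
    simp [mEval]

theorem exists_mul_left (a : Mat k n) (p : MPoly k n) :
    ∃ p' : MPoly k n, ∀ x, mEval x p' = mEval (a * x) p := by
  refine ⟨_, fun x => (mEval_aeval
    (Matrix.of fun i j => ∑ l, C (a i l) * X (l, j)) p x).trans ?_⟩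
  congr 1
  ext i j
  simp [Matrix.mul_apply, mEval]

theorem exists_mul_right (a : Mat k n) (p : MPoly k n) :
    ∃ p' : MPoly k n, ∀ x, mEval x p' = mEval (x * a) p := by
  refine ⟨_, fun x => (mEval_aeval
    (Matrix.of fun i j => ∑ l, X (i, l) * C (a l j)) p x).trans ?_⟩
  congr 1
  ext i j
  simp [Matrix.mul_apply, mEval]

/-- Comultiplication: `p (m * x)` is a finite sum of products of polynomials in `m` and `x`. -/
theorem exists_comul (p : MPoly k n) :
    ∃ (ι : Type) (_ : Fintype ι) (a b : ι → MPoly k n), ∀ m x : Mat k n,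
      mEval (m * x) p = ∑ t, mEval m (a t) * mEval x (b t) := by
  induction p using MvPolynomial.induction_on with
  | C c => exact ⟨Unit, inferInstance, fun _ => C c, fun _ => 1, by simp [mEval]⟩
  | add p q hp hq =>
    obtain ⟨ι, _, a, b, h⟩ := hp
    obtain ⟨ι', _, a', b', h'⟩ := hq
    exact ⟨ι ⊕ ι', inferInstance, Sum.elim a a', Sum.elim b b', fun m x => by
      simp [mEval_add, h, h']⟩
  | mul_X p ij hp =>
    obtain ⟨ι, _, a, b, h⟩ := hp
    refine ⟨ι × Fin n, inferInstance, fun t => a t.1 * X (ij.1, t.2),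
      fun t => b t.1 * X (t.2, ij.2), fun m x => ?_⟩
    have hX : mEval (m * x) (X ij) = ∑ l, m ij.1 l * x l ij.2 := by
      simp [mEval, Matrix.mul_apply]
    rw [mEval_mul, h, hX, Fintype.sum_mul_sum, Fintype.sum_prod_type]
    refine Finset.sum_congr rfl fun t _ => Finset.sum_congr rfl fun l _ => ?_
    simp only [mEval_mul]
    simp only [mEval, eval_X]
    ring

/-- The space of functions spanned by the left translates by `S` of the polynomials in `Q`. -/
def translates (S : Set (Mat k n)) (Q : Set (MPoly k n)) : Submodule k (Mat k n → k) :=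
  Submodule.span k {F | ∃ q ∈ Q, ∃ h ∈ S, F = fun x => mEval (h * x) q}

theorem mem_translates_of_mem {S : Set (Mat k n)} {Q : Set (MPoly k n)} {q : MPoly k n}
    {h : Mat k n} (hq : q ∈ Q) (hh : h ∈ S) : (fun x => mEval (h * x) q) ∈ translates S Q :=
  Submodule.subset_span ⟨q, hq, h, hh, rfl⟩

theorem translates_polynomial {S : Set (Mat k n)} {Q : Set (MPoly k n)} {F : Mat k n → k}
    (hF : F ∈ translates S Q) : ∃ p : MPoly k n, ∀ x, F x = mEval x p := by
  induction hF using Submodule.span_induction with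
  | mem F hF =>
    obtain ⟨q, -, h, -, rfl⟩ := hF
    obtain ⟨p, hp⟩ := exists_mul_left h q
    exact ⟨p, fun x => (hp x).symm⟩
  | zero => exact ⟨0, fun x => by simp [mEval]⟩
  | add F G _ _ hF hG =>
    obtain ⟨p, hp⟩ := hF
    obtain ⟨q, hq⟩ := hG
    exact ⟨p + q, fun x => by simp [mEval_add, hp, hq]⟩
  | smul c F _ hF =>
    obtain ⟨p, hp⟩ := hF
    exact ⟨C c * p, fun x => by simp [mEval_mul, mEval_C, hp]⟩

theorem translates_stable {S : Set (Mat k n)} (hS : ∀ a ∈ S, ∀ b ∈ S, a * b ∈ S)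
    {Q : Set (MPoly k n)} {F : Mat k n → k} (hF : F ∈ translates S Q) {g : Mat k n}
    (hg : g ∈ S) : (fun x => F (g * x)) ∈ translates S Q := by
  induction hF using Submodule.span_induction with
  | mem F hF =>
    obtain ⟨q, hq, h, hh, rfl⟩ := hF
    simpa only [← mul_assoc] using mem_translates_of_mem hq (hS h hh g hg)
  | zero => exact Submodule.zero_mem _
  | add F G _ _ hF hG => exact Submodule.add_mem _ hF hG
  | smul c F _ hF => exact Submodule.smul_mem _ c hF

theorem translates_vanish {S : Set (Mat k n)} (hS : ∀ a ∈ S, ∀ b ∈ S, a * b ∈ S)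
    {Q : Set (MPoly k n)} (hQ : ∀ q ∈ Q, VanishesOn S q) {F : Mat k n → k}
    (hF : F ∈ translates S Q) {x : Mat k n} (hx : x ∈ S) : F x = 0 := by
  induction hF using Submodule.span_induction with
  | mem F hF =>
    obtain ⟨q, hq, h, hh, rfl⟩ := hF
    exact hQ q hq _ (hS h hh x hx)
  | zero => rfl
  | add F G _ _ hF hG => simp [hF, hG]
  | smul c F _ hF => simp [hF]

theorem finiteDimensional_translates (S : Set (Mat k n)) {Q : Set (MPoly k n)} (hQ : Q.Finite) :
    FiniteDimensional k (translates S Q) := by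
  choose ι hι a b hab using exists_comul (k := k) (n := n)
  have hfin : (⋃ q ∈ Q, Set.range fun (t : ι q) (x : Mat k n) => mEval x (b q t)).Finite :=
    hQ.biUnion fun q _ => Set.finite_range _
  have := FiniteDimensional.span_of_finite k hfin
  refine Submodule.finiteDimensional_of_le (S₂ := Submodule.span k
    (⋃ q ∈ Q, Set.range fun (t : ι q) (x : Mat k n) => mEval x (b q t))) (Submodule.span_le.2 ?_)
  rintro _ ⟨q, hq, h, -, rfl⟩
  have : (fun x => mEval (h * x) q) =
      ∑ t, mEval h (a q t) • fun x : Mat k n => mEval x (b q t) := by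
    ext x
    simp [hab q h x]
  rw [this]
  refine Submodule.sum_mem _ fun t _ => Submodule.smul_mem _ _ (Submodule.subset_span ?_)
  exact Set.mem_biUnion hq ⟨t, rfl⟩

/-- A finite dimensional space of functions has a basis dual to evaluation at points. -/
theorem exists_dual_points {S : Type} (W : Submodule k (S → k)) [FiniteDimensional k W] :
    ∃ (d : ℕ) (z : Fin d → S) (w : Fin d → S → k), (∀ i, w i ∈ W) ∧
      (∀ i j, w i (z j) = if i = j then 1 else 0) ∧
      ∀ F ∈ W, ∀ x, F x = ∑ i, F (z i) * w i x := by
  let ev : S → Module.Dual k W := fun x => (LinearMap.proj x).comp W.subtype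
  have hspan : Submodule.span k (Set.range ev) = ⊤ := by
    refine Submodule.span_eq_top_of_ne_zero fun F hF => ?_
    by_contra! h
    exact hF (Subtype.ext (funext fun x => h (ev x) ⟨x, rfl⟩))
  let B := Module.Basis.ofSpan hspan.ge
  have hB : ∀ i, ∃ x, B i = ev x := fun i => by
    obtain ⟨x, hx⟩ := Module.Basis.ofSpan_subset hspan.ge ⟨i, rfl⟩
    exact ⟨x, hx.symm⟩
  let B' := Module.finBasis k (Module.Dual k W)
  let e := B.indexEquiv B'
  choose z hz using fun i => hB (e.symm i)
  let E := (B.reindex e)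
  have hE : ∀ i, E i = ev (z i) := fun i => by simp [E, hz]
  refine ⟨_, z, fun i x => E.repr (ev x) i, fun i => ?_, fun i j => ?_, fun F hF x => ?_⟩
  · obtain ⟨f, hf⟩ := (Module.evalEquiv k W).surjective (E.coord i)
    convert f.2 using 1
    ext x
    change E.coord i (ev x) = _
    rw [← hf]
    rfl
  · change E.repr (ev (z j)) i = _
    rw [← hE, Module.Basis.repr_self, Finsupp.single_apply]
    simp only [eq_comm]
  · have := congrArg (fun φ : Module.Dual k W => φ ⟨F, hF⟩) (E.sum_repr (ev x))
    simp only [hE, LinearMap.sum_apply, LinearMap.smul_apply, smul_eq_mul] at this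
    refine (this.symm.trans (Finset.sum_congr rfl fun i _ => mul_comm _ _))

/-- The unit group consists of the invertible matrices in the monoid. -/
theorem mem_unitGroup_iff {M : Set (Mat k n)} (hM : IsAlgMonoid M) {g : Mat k n} :
    g ∈ unitGroup M ↔ g ∈ M ∧ g.det ≠ 0 := by
  constructor
  · rintro ⟨hg, h, -, hgh, -⟩
    refine ⟨hg, fun h0 => ?_⟩
    have := congrArg Matrix.det hgh
    simp [h0] at this
  rintro ⟨hg, hdet⟩
  have hu : IsUnit g.det := isUnit_iff_ne_zero.2 hdet
  refine ⟨hg, g⁻¹, hM.zclosed.mem_of_vanishing fun p hp => ?_, Matrix.mul_nonsing_inv g hu,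
    Matrix.nonsing_inv_mul g hu⟩
  let W := translates M {p}
  have : FiniteDimensional k W := finiteDimensional_translates M (Set.finite_singleton p)
  let L : W →ₗ[k] W :=
    { toFun := fun F => ⟨fun x => F.1 (g * x), translates_stable hM.mul_mem F.2 hg⟩
      map_add' := fun _ _ => rfl
      map_smul' := fun _ _ => rfl }
  have hL : Function.Injective L := by
    intro F F' h
    ext x
    have := congrFun (congrArg Subtype.val h) (g⁻¹ * x)
    simpa [L, ← mul_assoc, Matrix.mul_nonsing_inv g hu] using this
  obtain ⟨F, hF⟩ := LinearMap.surjective_of_injective hL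
    ⟨_, mem_translates_of_mem (Set.mem_singleton p) hM.one_mem⟩
  have h1 := congrFun (congrArg Subtype.val hF) g⁻¹
  have h2 : F.1 1 = 0 := translates_vanish hM.mul_mem (fun q hq => Set.mem_singleton_iff.1 hq ▸ hp) F.2 hM.one_mem
  simpa [L, Matrix.mul_nonsing_inv g hu, h2] using h1.symm

/-- Finitely many regular functions on `M` are the coordinates of a vector in a right `M`-module,
whose stabilizer consists of the elements fixing all the functions under translation. -/
theorem exists_rightRep {M : Set (Mat k n)} (h1 : (1 : Mat k n) ∈ M)
    (hmul : ∀ a ∈ M, ∀ b ∈ M, a * b ∈ M) {κ : Type} [Fintype κ] (f : κ → MPoly k n) :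
    ∃ (d : ℕ) (P : Matrix (Fin d) (Fin d) (MPoly k n)) (v : Fin d → k), IsRightRep M P ∧
      ∀ g ∈ M, Matrix.vecMul v (repApply P g) = v ↔
        ∀ c, ∀ x ∈ M, mEval (g * x) (f c) = mEval x (f c) := by
  classical
  let W₀ := translates M (Set.range f)
  have : FiniteDimensional k W₀ := finiteDimensional_translates M (Set.finite_range f)
  let W : Submodule k (M → k) := W₀.map (LinearMap.funLeft k k Subtype.val)
  obtain ⟨d, z, w, hw, hwz, hexp⟩ := exists_dual_points W
  have hpoly : ∀ i, ∃ p : MPoly k n, (fun x => mEval x p) ∈ W₀ ∧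
      ∀ x : M, w i x = mEval x.1 p := fun i => by
    obtain ⟨F, hF, hFw⟩ := hw i
    obtain ⟨p, hp⟩ := translates_polynomial hF
    refine ⟨p, ?_, fun x => ?_⟩
    · have hpF : (fun x => mEval x p) = F := _root_.funext fun x => (hp x).symm
      exact hpF ▸ hF
    · rw [← hp, ← hFw]
      rfl
  choose q hqW hq using hpoly
  have hexp' : ∀ F ∈ W₀, ∀ m ∈ M, ∀ x ∈ M, F (m * x) = ∑ i, F (m * z i) * mEval x (q i) := by
    intro F hF m hm x hx
    have := hexp _ ⟨_, translates_stable hmul hF hm, rfl⟩ ⟨x, hx⟩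
    simpa only [hq, LinearMap.funLeft_apply] using this
  choose Q hQ using fun i j => exists_mul_right (z j).1 (q i)
  let Qm : Mat k n → Matrix (Fin d) (Fin d) k := fun m => Matrix.of fun i j => mEval (m * (z j).1) (q i)
  have hQ1 : Qm 1 = 1 := by
    ext i j
    simp [Qm, ← hq, hwz, Matrix.one_apply]
  have hQmul : ∀ a ∈ M, ∀ b ∈ M, Qm (a * b) = Qm a * Qm b := by
    intro a ha b hb
    ext i j
    have := hexp' _ (hqW i) a ha (b * (z j).1) (hmul b hb _ (z j).2)
    simpa [Qm, Matrix.mul_apply, mul_assoc] using this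
  let e := (Fintype.equivFin (Fin d × κ)).symm
  let P : Matrix _ _ (MPoly k n) := (Matrix.blockDiagonal fun _ : κ => Matrix.of Q).submatrix e e
  have hP : ∀ g, repApply P g = (Matrix.blockDiagonal fun _ : κ => Qm g).submatrix e e := by
    intro g
    ext i j
    simp only [repApply, P, Matrix.of_apply, Matrix.submatrix_apply, Matrix.blockDiagonal_apply]
    split_ifs
    · simp [hQ, Qm]
    · simp [mEval]
  refine ⟨_, P, fun i => mEval (z (e i).1).1 (f (e i).2), ⟨?_, fun a ha b hb => ?_⟩,
    fun g hg => ?_⟩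
  · rw [hP, hQ1]
    change (Matrix.blockDiagonal (1 : κ → Matrix (Fin d) (Fin d) k)).submatrix e e = 1
    rw [Matrix.blockDiagonal_one, Matrix.submatrix_one_equiv]
  · rw [hP, hP a, hP b, hQmul a ha b hb, Matrix.blockDiagonal_mul, Matrix.submatrix_mul_equiv]
  have hfW : ∀ c, (fun x => mEval x (f c)) ∈ W₀ := fun c => by
    simpa using mem_translates_of_mem (Set.mem_range_self c) h1
  have hvec : Matrix.vecMul (fun i => mEval (z (e i).1).1 (f (e i).2)) (repApply P g) =
      fun i => mEval (g * (z (e i).1).1) (f (e i).2) := by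
    ext i
    have h := hexp' _ (hfW (e i).2) 1 h1 _ (hmul g hg _ (z (e i).1).2)
    simp only [one_mul] at h
    rw [h, hP]
    simp only [Matrix.vecMul, dotProduct, Matrix.submatrix_apply]
    rw [Equiv.sum_comp e fun s => mEval (z s.1).1 (f s.2) *
      Matrix.blockDiagonal (fun _ : κ => Qm g) s (e i), Fintype.sum_prod_type]
    simp [Matrix.blockDiagonal_apply, Qm]
  rw [hvec]
  constructor
  · intro h c x hx
    have hz : ∀ j, mEval (g * (z j).1) (f c) = mEval (z j).1 (f c) := fun j => by
      have := congrFun h (e.symm (j, c))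
      simpa using this
    have h2 := hexp' _ (hfW c) g hg x hx
    have h3 := hexp' _ (hfW c) 1 h1 x hx
    simp only [one_mul] at h3
    rw [h2, h3]
    simp only [hz]
  · intro h
    ext i
    exact h _ _ (z (e i).1).2

theorem exists_algHom_isIntegral (K T Ω : Type) [Field K] [CommRing T] [Nontrivial T] [Algebra K T]
    [Algebra.FiniteType K T] [Field Ω] [IsAlgClosed Ω] [Algebra K Ω] :
    ∃ ψ : T →ₐ[K] Ω, ∀ t, IsIntegral K (ψ t) := by
  obtain ⟨m, hm⟩ := Ideal.exists_maximal T
  let _ : Field (T ⧸ m) := Ideal.Quotient.field m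
  have : Algebra.FiniteType K (T ⧸ m) :=
    Algebra.FiniteType.of_surjective (Ideal.Quotient.mkₐ K m) (Ideal.Quotient.mkₐ_surjective K m)
  have : Module.Finite K (T ⧸ m) := finite_of_finite_type_of_isJacobsonRing _ _
  let φ : (T ⧸ m) →ₐ[K] Ω := IsAlgClosed.lift
  exact ⟨φ.comp (Ideal.Quotient.mkₐ K m), fun t =>
    (Algebra.IsIntegral.isIntegral (R := K) (Ideal.Quotient.mkₐ K m t)).map φ⟩

open TensorProduct in
/-- A finite type algebra over a domain `B`, faithful over `B`, has a point with values in any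
algebraically closed field containing `B`; its coordinates become integral over `B` after
multiplication by nonzero elements of `B`. -/
theorem exists_algHom_exists_integral_multiple {B A' Ω : Type} [CommRing B] [IsDomain B]
    [CommRing A'] [Algebra B A'] [FaithfulSMul B A'] [Algebra.FiniteType B A'] [Field Ω]
    [IsAlgClosed Ω] [Algebra B Ω] [FaithfulSMul B Ω] :
    ∃ ψ : A' →ₐ[B] Ω, ∀ a, ∃ m : nonZeroDivisors B, IsIntegral B (m • ψ a) := by
  let K := FractionRing B
  let _ : Algebra K Ω := FractionRing.liftAlgebra B Ω
  have : Nontrivial (K ⊗[B] A') := (Algebra.TensorProduct.includeLeft_injective (S := B) (R := B)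
    (A := K) (B := A') (FaithfulSMul.algebraMap_injective B A')).nontrivial
  obtain ⟨ψ, hψ⟩ := exists_algHom_isIntegral K (K ⊗[B] A') Ω
  refine ⟨(ψ.restrictScalars B).comp Algebra.TensorProduct.includeRight, fun a => ?_⟩
  refine IsIntegral.exists_multiple_integral_of_isLocalization (nonZeroDivisors B) (Rₘ := K) _ ?_
  exact hψ _

/-- Points of a ring with values in an algebraically closed field lift along integral
extensions. -/
theorem exists_algHom_comp_eq {k R S : Type} [Field k] [IsAlgClosed k] [CommRing R] [CommRing S]
    [Algebra k R] [Algebra k S] [Algebra R S] [IsScalarTower k R S] [FaithfulSMul R S]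
    [Algebra.IsIntegral R S] (θ : R →ₐ[k] k) :
    ∃ Θ : S →ₐ[k] k, ∀ r, Θ (algebraMap R S r) = θ r := by
  have hmax : (RingHom.ker θ).IsMaximal :=
    RingHom.ker_isMaximal_of_surjective θ fun c => ⟨algebraMap k R c, by simp⟩
  obtain ⟨Q, hQ, hcomap⟩ := Ideal.exists_ideal_over_maximal_of_isIntegral (S := S)
    (RingHom.ker θ) (by
      rw [(RingHom.injective_iff_ker_eq_bot _).1 (FaithfulSMul.algebraMap_injective R S)]
      exact bot_le)
  let _ : Field (S ⧸ Q) := Ideal.Quotient.field Q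
  have hθ : ∀ r, Ideal.Quotient.mk Q (algebraMap R S r) = algebraMap k (S ⧸ Q) (θ r) := fun r => by
    have h : r - algebraMap k R (θ r) ∈ Q.comap (algebraMap R S) := by
      rw [hcomap, RingHom.mem_ker]
      simp
    rw [Ideal.mem_comap, map_sub, ← IsScalarTower.algebraMap_apply] at h
    exact Ideal.Quotient.eq.2 h
  have : Algebra.IsIntegral k (S ⧸ Q) := ⟨fun y => by
    obtain ⟨s, rfl⟩ := Ideal.Quotient.mk_surjective y
    obtain ⟨p, hp, hps⟩ := Algebra.IsIntegral.isIntegral (R := R) s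
    refine ⟨p.map (θ : R →+* k), hp.map _, ?_⟩
    have hc : (algebraMap k (S ⧸ Q)).comp (θ : R →+* k)
        = (Ideal.Quotient.mk Q).comp (algebraMap R S) := RingHom.ext fun r => (hθ r).symm
    rw [Polynomial.eval₂_map, hc, ← Polynomial.hom_eval₂, hps, map_zero]⟩
  let e : k ≃ₐ[k] S ⧸ Q := AlgEquiv.ofBijective (Algebra.ofId k _)
    IsAlgClosed.algebraMap_bijective_of_isIntegral
  refine ⟨(e.symm : (S ⧸ Q) →ₐ[k] k).comp (Ideal.Quotient.mkₐ k Q), fun r => ?_⟩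
  change e.symm (Ideal.Quotient.mk Q (algebraMap R S r)) = θ r
  rw [hθ, AlgEquiv.commutes]
  rfl

/-- A generic point of an algebra `A'` over a subalgebra `B` of a domain `A` specializes: any
`k`-point of `A` outside a fixed hypersurface extends to a ring containing `A` and receiving `A'`,
compatibly on `B`. -/
theorem exists_specialization {k A A' : Type} [Field k] [IsAlgClosed k] [CommRing A] [IsDomain A]
    [Algebra k A] [CommRing A'] [Algebra k A'] [Algebra.FiniteType k A'] (B : Subalgebra k A)
    (ι : B →ₐ[k] A') (hι : Function.Injective ι) :
    ∃ b : B, b ≠ 0 ∧ ∀ θ : A →ₐ[k] k, θ b ≠ 0 →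
      ∃ (R : Type) (_ : CommRing R) (_ : IsDomain R) (_ : Algebra k R) (j : A →ₐ[k] R)
        (ψ : A' →ₐ[k] R) (Θ : R →ₐ[k] k), Function.Injective j ∧ (∀ a, Θ (j a) = θ a) ∧
          ∀ b, ψ (ι b) = j b := by
  classical
  let Ω := AlgebraicClosure (FractionRing A)
  have hAΩ : Function.Injective (algebraMap A Ω) := by
    rw [IsScalarTower.algebraMap_eq A (FractionRing A) Ω]
    exact (algebraMap (FractionRing A) Ω).injective.comp (IsFractionRing.injective A _)
  let _ : Algebra B A' := ι.toRingHom.toAlgebra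
  have : IsScalarTower k B A' := IsScalarTower.of_algebraMap_eq fun c => (ι.commutes c).symm
  have : FaithfulSMul B A' := (faithfulSMul_iff_algebraMap_injective B A').2 hι
  have : FaithfulSMul B Ω := (faithfulSMul_iff_algebraMap_injective B Ω).2
    (hAΩ.comp Subtype.val_injective)
  have : Algebra.FiniteType B A' := Algebra.FiniteType.of_restrictScalars_finiteType k B A'
  obtain ⟨ψ, hψ⟩ := exists_algHom_exists_integral_multiple (B := B) (A' := A') (Ω := Ω)
  choose m hm using hψ
  obtain ⟨s, hs⟩ := (inferInstance : Algebra.FiniteType k A').out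
  let b : B := ∏ a ∈ s, (m a : B)
  have hb : b ≠ 0 := Finset.prod_ne_zero_iff.2 fun a _ => nonZeroDivisors.coe_ne_zero (m a)
  refine ⟨b, hb, fun θ hθ => ?_⟩
  have hbA : (b : A) ≠ 0 := fun h => hb (Subtype.ext h)
  let R₀ := Localization.Away (b : A)
  let lift : R₀ →+* Ω := IsLocalization.Away.lift (b : A) (g := algebraMap A Ω)
    (isUnit_iff_ne_zero.2 ((map_ne_zero_iff _ hAΩ).2 hbA))
  have hlift : ∀ a, lift (algebraMap A R₀ a) = algebraMap A Ω a := fun a =>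
    IsLocalization.Away.lift_eq (b : A) _ a
  let _ : Algebra R₀ Ω := lift.toAlgebra
  have : IsScalarTower A R₀ Ω := IsScalarTower.of_algebraMap_eq fun a => (hlift a).symm
  have : IsScalarTower k R₀ Ω := IsScalarTower.of_algebraMap_eq fun c => by
    rw [IsScalarTower.algebraMap_apply k A R₀, ← IsScalarTower.algebraMap_apply A R₀ Ω,
      ← IsScalarTower.algebraMap_apply k A Ω]
  have hAR₀ : Function.Injective (algebraMap A R₀) := fun x y h => hAΩ (by
    rw [← hlift, ← hlift, h])
  have hR₀Ω : Function.Injective (algebraMap R₀ Ω) := by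
    refine (IsLocalization.lift_injective_iff (M := Submonoid.powers (b : A)) (S := R₀) _).2
      fun x y => ?_
    rw [hAR₀.eq_iff, hAΩ.eq_iff]
  have : FaithfulSMul R₀ Ω := (faithfulSMul_iff_algebraMap_injective R₀ Ω).2 hR₀Ω
  have hθu : IsUnit ((θ : A →+* k) b) := isUnit_iff_ne_zero.2 hθ
  let θ₁ : R₀ →+* k := IsLocalization.Away.lift (b : A) hθu
  have hθ₁ : ∀ a, θ₁ (algebraMap A R₀ a) = θ a := fun a =>
    IsLocalization.Away.lift_eq (b : A) hθu a
  let θ₀ : R₀ →ₐ[k] k :=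
    { θ₁ with
      commutes' := fun c => by
        rw [IsScalarTower.algebraMap_apply k A R₀]
        exact (hθ₁ _).trans (θ.commutes c) }
  let R := integralClosure R₀ Ω
  have hR₀R : Function.Injective (algebraMap R₀ R) := fun x y h => hR₀Ω (congrArg R.val h)
  have : FaithfulSMul R₀ R := (faithfulSMul_iff_algebraMap_injective R₀ R).2 hR₀R
  obtain ⟨Θ, hΘ⟩ := exists_algHom_comp_eq (S := R) θ₀
  have hψR : ∀ a, ψ a ∈ R.restrictScalars k := by
    have hle : (⊤ : Subalgebra k A') ≤
        (R.restrictScalars k).comap (ψ.restrictScalars k) := by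
      rw [← hs]
      refine Algebra.adjoin_le fun a ha => ?_
      have hdvd : (m a : B) ∣ b := Finset.dvd_prod_of_mem (fun a => (m a : B)) ha
      have hu : IsUnit (algebraMap A R₀ (m a : B)) := isUnit_of_dvd_unit
        (map_dvd (algebraMap A R₀) (map_dvd B.val hdvd))
        (IsLocalization.Away.algebraMap_isUnit (b : A))
      obtain ⟨u, hu⟩ := hu.exists_left_inv
      have hint : IsIntegral R₀ (m a • ψ a) := by
        obtain ⟨p, hp, hpe⟩ := hm a
        refine ⟨p.map ((algebraMap A R₀).comp (algebraMap B A)), hp.map _, ?_⟩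
        rw [Polynomial.eval₂_map, ← RingHom.comp_assoc, ← IsScalarTower.algebraMap_eq A R₀ Ω]
        exact hpe
      have hmul : ψ a = algebraMap R₀ Ω u * (m a • ψ a) := by
        rw [show m a • ψ a = algebraMap R₀ Ω (algebraMap A R₀ (m a : B)) * ψ a by
          rw [← IsScalarTower.algebraMap_apply A R₀ Ω]
          exact Algebra.smul_def (m a : B) (ψ a), ← mul_assoc, ← map_mul, hu, map_one, one_mul]
      change IsIntegral R₀ (ψ a)
      rw [hmul]
      exact isIntegral_algebraMap.mul hint
    exact fun a => hle Algebra.mem_top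
  let j : A →ₐ[k] R := (IsScalarTower.toAlgHom k R₀ R).comp (IsScalarTower.toAlgHom k A R₀)
  refine ⟨R, inferInstance, inferInstance, inferInstance, j,
    (ψ.restrictScalars k).codRestrict (R.restrictScalars k) hψR, Θ, ?_, ?_, ?_⟩
  · exact hR₀R.comp hAR₀
  · exact fun a => (hΘ _).trans (hθ₁ a)
  · intro c
    refine Subtype.ext ?_
    change ψ (algebraMap B A' c) = algebraMap R₀ Ω (algebraMap A R₀ c)
    rw [AlgHom.commutes, ← IsScalarTower.algebraMap_apply]
    rfl

theorem IsClosedIn.zclosed {Y X : Set (Mat k n)} (h : IsClosedIn Y X) (hX : ZClosed X) :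
    ZClosed Y := by
  obtain ⟨-, C, ⟨S, rfl⟩, rfl⟩ := h
  obtain ⟨T, rfl⟩ := hX
  refine ⟨S ∪ T, Set.ext fun x => ⟨fun hx p hp => hp.elim (hx.1 p) (hx.2 p), fun hx => ?_⟩⟩
  exact ⟨fun p hp => hx p (Or.inl hp), fun p hp => hx p (Or.inr hp)⟩

theorem IrreducibleSet.exists_ne_zero {X : Set (Mat k n)} (hX : IrreducibleSet X)
    {p q : MPoly k n} (hp : ¬ VanishesOn X p) (hq : ¬ VanishesOn X q) :
    ∃ x ∈ X, mEval x p ≠ 0 ∧ mEval x q ≠ 0 := by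
  by_contra! h
  refine (hX.2 p q fun x hx => ?_).elim hp hq
  rw [mEval_mul, mul_eq_zero]
  exact or_iff_not_imp_left.2 (h x hx)

theorem IsAlgMonoid.not_vanishesOn_detPoly {M : Set (Mat k n)} (hM : IsAlgMonoid M) :
    ¬ VanishesOn M (detPoly k n) := fun h => by
  simpa [mEval_detPoly] using h 1 hM.one_mem

theorem mEval_adjugate {d : ℕ} (B : Matrix (Fin d) (Fin d) (MPoly k n)) (x : Mat k n) :
    (B.adjugate).map (mEval x) = (B.map (mEval x)).adjugate :=
  RingHom.map_adjugate (eval fun ij : Fin n × Fin n => x ij.1 ij.2) B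

/-- An observable subgroup is the stabilizer of a vector in a right module. -/
theorem LeftObservable.exists_stabilizer {M H : Set (Mat k n)} (hM : IsAlgMonoid M)
    (hMirr : IrreducibleSet M) (hH : IsSubgroupOf H (unitGroup M)) (hHcl : IsClosedIn H M)
    (hobs : LeftObservable H M) :
    ∃ (d : ℕ) (P : Matrix (Fin d) (Fin d) (MPoly k n)) (v : Fin d → k),
      IsRightRep M P ∧ {g ∈ unitGroup M | Matrix.vecMul v (repApply P g) = v} = H := by
  classical
  obtain ⟨hHG, hH1, hHmul, hHinv⟩ := hH
  have hHM : H ⊆ M := hHcl.1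
  have hHZ := hHcl.zclosed hM.zclosed
  obtain ⟨Q, hQ⟩ := IsNoetherian.noetherian (idealOf H)
  let W := translates H (Q : Set (MPoly k n))
  have : FiniteDimensional k W := finiteDimensional_translates H Q.finite_toSet
  obtain ⟨d, z, w, hw, hwz, hexp⟩ := exists_dual_points W
  have hWH : ∀ i, ∀ x ∈ H, w i x = 0 := fun i x hx =>
    translates_vanish hHmul (fun q hq => hQ.le (Submodule.subset_span hq)) (hw i) hx
  choose e he using fun i => translates_polynomial (hw i)
  have hright : ∀ i a, ∃ p : MPoly k n, ∀ x, mEval x p = w i (x * a) := fun i a => by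
    obtain ⟨p, hp⟩ := exists_mul_right a (e i)
    exact ⟨p, fun x => by rw [hp, he]⟩
  choose R hR using hright
  let B : Mat k n → Matrix (Fin d) (Fin d) k := fun x => Matrix.of fun i a => w i (x * z a)
  let Bp : Matrix (Fin d) (Fin d) (MPoly k n) := Matrix.of fun i a => R i (z a)
  have hBp : ∀ x, Bp.map (mEval x) = B x := fun x => by
    ext i a
    simp [Bp, B, hR]
  have htrans : ∀ i, ∀ h ∈ H, ∀ x, w i (h * x) = ∑ l, w i (h * z l) * w l x := fun i h hh x =>
    hexp _ (translates_stable hHmul (hw i) hh) x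
  have hBmul : ∀ h ∈ H, ∀ x, B (h * x) = B h * B x := fun h hh x => by
    ext i a
    simp only [B, Matrix.of_apply, Matrix.mul_apply, mul_assoc, htrans i h hh (x * z a)]
  have hB1 : B 1 = 1 := by
    ext i a
    simp [B, hwz, Matrix.one_apply]
  have hχ : ∀ h ∈ H, (B h).det ≠ 0 := fun h hh h0 => by
    obtain ⟨h', -, hmul, -⟩ := hHinv h hh
    have := congrArg Matrix.det (hBmul h hh h')
    simp [hmul, hB1, h0] at this
  let p := Bp.det
  have hp : ∀ x, mEval x p = (B x).det := fun x => by rw [mEval_det, hBp]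
  have hpM : ¬ VanishesOn M p := fun h => by simpa [hp, hB1] using h 1 hM.one_mem
  have hpH : ∀ h ∈ H, ∀ x, mEval (h * x) p = (B h).det * mEval x p := fun h hh x => by
    rw [hp, hp, hBmul h hh, Matrix.det_mul]
  obtain ⟨u, hu, huM, huH⟩ := hobs (idealOf M ⊔ Ideal.span {p})
    (fun q hq => Ideal.mem_sup_left hq)
    (fun q hq h hh => by
      obtain ⟨i, hi, t, ht, rfl⟩ := Submodule.mem_sup.1 hq
      obtain ⟨a, rfl⟩ := Ideal.mem_span_singleton'.1 ht
      obtain ⟨a', ha'⟩ := exists_mul_left h a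
      refine ⟨C (B h).det * a' * p,
        Ideal.mem_sup_right (Ideal.mul_mem_left _ _ (Ideal.mem_span_singleton_self p)), ?_⟩
      intro m hm
      rw [mEval_add, mEval_mul, mEval_mul, mEval_mul, mEval_C, ha', hpH h hh,
        hi _ (hM.mul_mem _ (hHM hh) _ hm)]
      ring)
    ⟨p, Ideal.mem_sup_right (Ideal.mem_span_singleton_self p), hpM⟩
  obtain ⟨i, hi, t, ht, rfl⟩ := Submodule.mem_sup.1 hu
  obtain ⟨f, rfl⟩ := Ideal.mem_span_singleton'.1 ht
  have huf : ∀ x ∈ M, mEval x (i + f * p) = mEval x f * mEval x p := fun x hx => by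
    rw [mEval_add, hi x hx, zero_add, mEval_mul]
  have hf : ∀ h ∈ H, ∀ x ∈ M, (B h).det * mEval (h * x) f = mEval x f := by
    intro h hh x hx
    obtain ⟨f', hf'⟩ := exists_mul_left h f
    have hv : VanishesOn M (p * (C (B h).det * f' - f)) := fun y hy => by
      have := huH h hh y hy
      rw [huf y hy, huf _ (hM.mul_mem _ (hHM hh) _ hy), hpH h hh] at this
      rw [mEval_mul, mEval_sub, mEval_mul, mEval_C, hf']
      linear_combination this
    have := (hMirr.2 _ _ hv).resolve_left hpM x hx
    rwa [mEval_sub, mEval_mul, mEval_C, hf', sub_eq_zero] at this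
  obtain ⟨x, hx, hdet, hux⟩ := hMirr.exists_ne_zero hM.not_vanishesOn_detPoly huM
  rw [mEval_detPoly] at hdet
  rw [huf x hx] at hux
  have hxu : IsUnit x.det := isUnit_iff_ne_zero.2 hdet
  let U : Mat k n → Fin d → k := fun y l => w l (y * x⁻¹)
  let q : Fin d → MPoly k n := fun a => ∑ l, Bp.adjugate a l * R l x⁻¹
  have hq : ∀ y, (fun a => mEval y (q a)) = (B y).adjugate.mulVec (U y) := fun y => by
    ext a
    rw [← hBp, ← mEval_adjugate]
    simp [q, mEval_sum, mEval_mul, Matrix.mulVec, dotProduct, hR, U]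
  have hqH : ∀ h ∈ H, ∀ y a, mEval (h * y) (q a) = (B h).det * mEval y (q a) := by
    intro h hh y a
    have hU : U (h * y) = (B h).mulVec (U y) := by
      ext l
      exact (congrArg (w l) (mul_assoc h y x⁻¹)).trans (htrans l h hh _)
    have hqy : mEval y (q a) = (B y).adjugate.mulVec (U y) a := congrFun (hq y) a
    have hqhy : mEval (h * y) (q a) = (B (h * y)).adjugate.mulVec (U (h * y)) a :=
      congrFun (hq (h * y)) a
    rw [hqhy, hqy, hU, hBmul h hh, Matrix.adjugate_mul_distrib, Matrix.mulVec_mulVec,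
      Matrix.mul_assoc, Matrix.adjugate_mul, Matrix.mul_smul, Matrix.mul_one, Matrix.smul_mulVec,
      Pi.smul_apply, smul_eq_mul]
  obtain ⟨D, P, v, hP, hstab⟩ := exists_rightRep hM.one_mem hM.mul_mem
    (fun c : Option (Fin d) => f * c.elim p q)
  refine ⟨D, P, v, hP, Set.Subset.antisymm ?_ fun h hh => ⟨hHG hh, ?_⟩⟩
  · rintro g ⟨hg, hgv⟩
    have hgM := hg.1
    have hinv := (hstab g hgM).1 hgv
    have hfp := hinv none x hx
    simp only [Option.elim_none, mEval_mul] at hfp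
    rw [← hfp] at hux
    have hUx : U x = 0 := by
      ext l
      simp only [U, Matrix.mul_nonsing_inv x hxu]
      exact hWH l 1 hH1
    have hq0 : (fun a => mEval (g * x) (q a)) = 0 := by
      ext a
      have hfq := hinv (some a) x hx
      have hqx : mEval x (q a) = 0 := by
        have := congrFun (hq x) a
        simpa [hUx] using this
      simp only [Option.elim_some, mEval_mul, hqx, mul_zero] at hfq
      exact (mul_eq_zero.1 hfq).resolve_left (left_ne_zero_of_mul hux)
    have hU0 : U (g * x) = 0 := by
      have h0 := congrArg (B (g * x)).mulVec ((hq (g * x)).symm.trans hq0)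
      rw [Matrix.mulVec_mulVec, Matrix.mul_adjugate, Matrix.mulVec_zero, Matrix.smul_mulVec,
        Matrix.one_mulVec, ← hp] at h0
      exact (smul_eq_zero.1 h0).resolve_left (right_ne_zero_of_mul hux)
    have hwg : ∀ l, w l g = 0 := fun l => by
      have := congrFun hU0 l
      simpa [U, mul_assoc, Matrix.mul_nonsing_inv x hxu] using this
    refine hHZ.mem_of_vanishing fun r hr => ?_
    have hle : idealOf H ≤ idealOf {g} := by
      rw [← hQ]
      refine Submodule.span_le.2 fun r hr y hy => ?_
      obtain rfl := Set.mem_singleton_iff.1 hy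
      have := hexp _ (mem_translates_of_mem hr hH1) y
      simpa [hwg] using this
    exact hle hr g rfl
  · refine (hstab h (hHM hh)).2 fun c y hy => ?_
    rw [mEval_mul, mEval_mul, ← hf h hh y hy]
    cases c with
    | none =>
      simp only [Option.elim_none, hpH h hh]
      ring
    | some a =>
      simp only [Option.elim_some, hqH h hh]
      ring

theorem IrreducibleSet.isPrime_idealOf {X : Set (Mat k n)} (hX : IrreducibleSet X) :
    (idealOf X).IsPrime := by
  refine (Ideal.isPrime_iff).2 ⟨fun h => ?_, fun {p q} hpq => hX.2 p q hpq⟩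
  obtain ⟨x, hx⟩ := hX.1
  have h1 : (1 : MPoly k n) ∈ idealOf X := h ▸ Submodule.mem_top
  simpa [mEval] using h1 x hx

/-- Matrices not separated by the generators of an algebra of polynomials are not separated by
the algebra. -/
theorem mEval_eq_of_mem_adjoin {S : Set (MPoly k n)} {x y : Mat k n}
    (h : ∀ p ∈ S, mEval x p = mEval y p) {p : MPoly k n} (hp : p ∈ Algebra.adjoin k S) :
    mEval x p = mEval y p := by
  have hle : Algebra.adjoin k S ≤ AlgHom.equalizer
      (aeval fun ij : Fin n × Fin n => x ij.1 ij.2) (aeval fun ij : Fin n × Fin n => y ij.1 ij.2) :=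
    Algebra.adjoin_le fun p hp => by
      change _ = _
      rw [← mEval_eq_aeval, ← mEval_eq_aeval, h p hp]
  rw [mEval_eq_aeval, mEval_eq_aeval]
  exact hle hp

theorem exists_specialization_of_irreducible [IsAlgClosed k] {M : Set (Mat k n)}
    (hM : IrreducibleSet M) {A' : Type} [CommRing A'] [Algebra k A'] [Algebra.FiniteType k A']
    (f : MPoly k n →ₐ[k] A') (hfM : ∀ p ∈ idealOf M, f p = 0) (S : Set (MPoly k n))
    (hf : ∀ p ∈ Algebra.adjoin k S, f p = 0 → VanishesOn M p) :
    ∃ b ∈ Algebra.adjoin k S, ¬ VanishesOn M b ∧ ∀ x ∈ M, mEval x b ≠ 0 →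
      ∃ (R : Type) (_ : CommRing R) (_ : IsDomain R) (_ : Algebra k R) (j : MPoly k n →ₐ[k] R)
        (ψ : A' →ₐ[k] R) (Θ : R →ₐ[k] k), (∀ p, j p = 0 ↔ VanishesOn M p) ∧
          (∀ p, Θ (j p) = mEval x p) ∧ ∀ p ∈ S, ψ (f p) = j p := by
  have := hM.isPrime_idealOf
  let π : MPoly k n →ₐ[k] MPoly k n ⧸ idealOf M := Ideal.Quotient.mkₐ k (idealOf M)
  have hπ : ∀ p, π p = 0 ↔ VanishesOn M p := fun p => Ideal.Quotient.eq_zero_iff_mem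
  let F : (MPoly k n ⧸ idealOf M) →ₐ[k] A' := Ideal.Quotient.liftₐ (idealOf M) f hfM
  have hF : ∀ p, F (π p) = f p := fun p => rfl
  obtain ⟨⟨_, b, hb, rfl⟩, hb0, H⟩ := exists_specialization ((Algebra.adjoin k S).map π)
    (F.comp (Subalgebra.val _)) ((injective_iff_map_eq_zero _).2 (by
      rintro ⟨_, p, hp, rfl⟩ h
      exact Subtype.ext ((hπ p).2 (hf p hp h))))
  refine ⟨b, hb, fun h => hb0 (Subtype.ext ((hπ b).2 h)), fun x hx hxb => ?_⟩
  let θ : (MPoly k n ⧸ idealOf M) →ₐ[k] k := Ideal.Quotient.liftₐ (idealOf M)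
    (aeval fun ij : Fin n × Fin n => x ij.1 ij.2) fun p hp => by
      rw [← mEval_eq_aeval]
      exact hp x hx
  have hθ : ∀ p, θ (π p) = mEval x p := fun p => (mEval_eq_aeval x p).symm
  obtain ⟨R, hR, hRd, hRk, j, ψ, Θ, hj, hΘ, hψ⟩ := H θ (by
    change θ (π b) ≠ 0
    rwa [hθ])
  refine ⟨R, hR, hRd, hRk, j.comp π, ψ, Θ, fun p => ?_, fun p => ?_, fun p hp => ?_⟩
  · rw [← hπ]
    exact map_eq_zero_iff j hj
  · exact (hΘ _).trans (hθ p)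
  · exact hψ ⟨π p, p, Algebra.subset_adjoin hp, rfl⟩

/-- A polynomial vanishing on the common zeros of `S` vanishes at every point over a reduced
algebra at which `S` vanishes. -/
theorem algHom_eq_zero_of_zeros [IsAlgClosed k] {σ R : Type} [Finite σ] [CommRing R] [IsReduced R]
    [Algebra k R] (φ : MvPolynomial σ k →ₐ[k] R) {S : Set (MvPolynomial σ k)}
    (hS : ∀ s ∈ S, φ s = 0) {p : MvPolynomial σ k}
    (hp : ∀ y : σ → k, (∀ s ∈ S, aeval y s = 0) → aeval y p = 0) : φ p = 0 := by
  have hmem : p ∈ vanishingIdeal k (zeroLocus k (Ideal.span S)) := fun y hy =>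
    hp y fun s hs => hy s (Ideal.subset_span hs)
  rw [vanishingIdeal_zeroLocus_eq_radical] at hmem
  obtain ⟨N, hN⟩ := hmem
  have hle : Ideal.span S ≤ RingHom.ker φ := Ideal.span_le.2 hS
  have h0 : φ (p ^ N) = 0 := hle hN
  rw [map_pow] at h0
  exact eq_zero_of_pow_eq_zero h0

/-- The determinant is invertible as a regular function on a closed set of invertible matrices. -/
theorem ZClosed.exists_det_mul_eq_one [IsAlgClosed k] {H : Set (Mat k n)} (hH : ZClosed H)
    (hdet : ∀ g ∈ H, g.det ≠ 0) : ∃ q : MPoly k n, ∀ g ∈ H, g.det * mEval g q = 1 := by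
  let I := idealOf H ⊔ Ideal.span {detPoly k n}
  have hI : (1 : MPoly k n) ∈ I := by
    rw [← Ideal.Quotient.eq_zero_iff_mem]
    by_contra h1
    have hI : I ≠ ⊤ := fun h => h1 (Ideal.Quotient.eq_zero_iff_mem.2 (h ▸ Submodule.mem_top))
    obtain ⟨m, hm, hIm⟩ := Ideal.exists_le_maximal I hI
    obtain ⟨y, rfl⟩ := eq_vanishingIdeal_singleton_of_isMaximal k hm
    let g : Mat k n := Matrix.of fun i j => y (i, j)
    have hg : ∀ p ∈ I, mEval g p = 0 := fun p hp => by
      rw [mEval_eq_aeval]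
      exact hIm hp y rfl
    refine hdet g (hH.mem_of_vanishing fun p hp => hg p (Ideal.mem_sup_left hp)) ?_
    rw [← mEval_detPoly]
    exact hg _ (Ideal.mem_sup_right (Ideal.mem_span_singleton_self _))
  obtain ⟨i, hi, t, ht, h⟩ := Submodule.mem_sup.1 hI
  obtain ⟨q, rfl⟩ := Ideal.mem_span_singleton'.1 ht
  refine ⟨q, fun g hg => ?_⟩
  have := congrArg (mEval g) h
  rw [mEval_add, hi g hg, mEval_mul, mEval_detPoly] at this
  rw [mul_comm, ← zero_add (_ * _), this]
  simp [mEval]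

theorem IsAlgMonoid.inv_mem {M : Set (Mat k n)} (hM : IsAlgMonoid M) {g : Mat k n} (hg : g ∈ M)
    (hdet : g.det ≠ 0) : g⁻¹ ∈ M := by
  obtain ⟨-, h, hh, hgh, -⟩ := (mem_unitGroup_iff hM).2 ⟨hg, hdet⟩
  rwa [Matrix.inv_eq_right_inv hgh]

/-- The coordinates of the orbit map `x ↦ v · x`. -/
noncomputable def orbitCoord {d : ℕ} (P : Matrix (Fin d) (Fin d) (MPoly k n)) (v : Fin d → k)
    (i : Fin d) : MPoly k n :=
  ∑ l, C (v l) * P l i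

theorem mEval_orbitCoord {d : ℕ} (P : Matrix (Fin d) (Fin d) (MPoly k n)) (v : Fin d → k)
    (i : Fin d) (x : Mat k n) :
    mEval x (orbitCoord P v i) = Matrix.vecMul v (repApply P x) i := by
  simp [orbitCoord, mEval_sum, mEval_mul, mEval_C, Matrix.vecMul, dotProduct, repApply]

theorem IsRightRep.vecMul_mul {M : Set (Mat k n)} {d : ℕ}
    {P : Matrix (Fin d) (Fin d) (MPoly k n)} (hP : IsRightRep M P) (v : Fin d → k) {x y : Mat k n}
    (hx : x ∈ M) (hy : y ∈ M) :
    Matrix.vecMul v (repApply P (x * y)) =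
      Matrix.vecMul (Matrix.vecMul v (repApply P x)) (repApply P y) := by
  rw [hP.2 x hx y hy, Matrix.vecMul_vecMul]

theorem IsRightRep.vecMul_mul_inv {M : Set (Mat k n)} (hM : IsAlgMonoid M) {d : ℕ}
    {P : Matrix (Fin d) (Fin d) (MPoly k n)} (hP : IsRightRep M P) {v : Fin d → k} {x y : Mat k n}
    (hx : x ∈ M) (hy : y ∈ M) (hdet : y.det ≠ 0)
    (h : ∀ i, mEval x (orbitCoord P v i) = mEval y (orbitCoord P v i)) :
    Matrix.vecMul v (repApply P (x * y⁻¹)) = v := by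
  have hxy : Matrix.vecMul v (repApply P x) = Matrix.vecMul v (repApply P y) := by
    ext i
    rw [← mEval_orbitCoord, h, mEval_orbitCoord]
  have hy' := hM.inv_mem hy hdet
  rw [hP.vecMul_mul v hx hy', hxy, ← hP.vecMul_mul v hy hy',
    Matrix.mul_nonsing_inv _ (isUnit_iff_ne_zero.2 hdet), hP.1, Matrix.vecMul_one]

/-- If the stabilizer of `v` among the units is closed, then it contains every element of the
monoid fixing `v`. -/
theorem IsRightRep.det_ne_zero_of_fixed [IsAlgClosed k] {M : Set (Mat k n)} (hM : IsAlgMonoid M)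
    (hMirr : IrreducibleSet M) {d : ℕ} {P : Matrix (Fin d) (Fin d) (MPoly k n)}
    (hP : IsRightRep M P) {v : Fin d → k}
    (hcl : ZClosed {g ∈ unitGroup M | Matrix.vecMul v (repApply P g) = v}) {x : Mat k n}
    (hx : x ∈ M) (hxv : Matrix.vecMul v (repApply P x) = v) : x.det ≠ 0 := by
  intro hx0
  have := hMirr.isPrime_idealOf
  obtain ⟨q, hq⟩ := hcl.exists_det_mul_eq_one fun g hg => ((mem_unitGroup_iff hM).1 hg.1).2
  let A := MPoly k n ⧸ idealOf M
  let δ : A := Ideal.Quotient.mk _ (detPoly k n)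
  have hδ : δ ≠ 0 := fun h => hM.not_vanishesOn_detPoly (Ideal.Quotient.eq_zero_iff_mem.1 h)
  let A' := Localization.Away δ
  let f : MPoly k n →ₐ[k] A' := (IsScalarTower.toAlgHom k A A').comp (Ideal.Quotient.mkₐ k _)
  have hf : ∀ p, f p = algebraMap A A' (Ideal.Quotient.mk _ p) := fun p => rfl
  have hinj : Function.Injective (algebraMap A A') :=
    IsLocalization.injective A' (powers_le_nonZeroDivisors_of_noZeroDivisors hδ)
  have : Algebra.FiniteType k A' := inferInstance
  obtain ⟨b, hb, hbM, H⟩ := exists_specialization_of_irreducible hMirr f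
    (fun p hp => by rw [hf, Ideal.Quotient.eq_zero_iff_mem.2 hp, map_zero])
    (Set.range (orbitCoord P v)) (fun p _ hp => by
      rw [hf, map_eq_zero_iff _ hinj] at hp
      exact Ideal.Quotient.eq_zero_iff_mem.1 hp)
  obtain ⟨h, hh, hhb⟩ : ∃ h ∈ M, mEval h b ≠ 0 := by
    simpa only [VanishesOn, not_forall, exists_prop] using hbM
  have hxh : mEval (x * h) b = mEval h b := mEval_eq_of_mem_adjoin (by
    rintro _ ⟨i, rfl⟩
    rw [mEval_orbitCoord, mEval_orbitCoord, hP.vecMul_mul v hx hh, hxv]) hb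
  obtain ⟨R, _, _, _, j, ψ, Θ, hj, hΘ, hψ⟩ := H (x * h) (hM.mul_mem _ hx _ hh) (hxh ▸ hhb)
  let N := Fin n × Fin n
  let inX : MPoly k n →ₐ[k] MvPolynomial ((N ⊕ N) ⊕ Unit) k := rename (Sum.inl ∘ Sum.inl)
  let inY : MPoly k n →ₐ[k] MvPolynomial ((N ⊕ N) ⊕ Unit) k := rename (Sum.inl ∘ Sum.inr)
  let T : MvPolynomial ((N ⊕ N) ⊕ Unit) k := X (Sum.inr ())
  let t : R := ψ (IsLocalization.Away.invSelf δ)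
  let φ : MvPolynomial ((N ⊕ N) ⊕ Unit) k →ₐ[k] R :=
    aeval (Sum.elim (Sum.elim (fun ij => j (X ij)) fun ij => ψ (f (X ij))) fun _ => t)
  have hφX : ∀ p, φ (inX p) = j p := fun p => by
    have : φ.comp inX = j := algHom_ext (fun ij => by simp [φ, inX])
    exact DFunLike.congr_fun this p
  have hφY : ∀ p, φ (inY p) = ψ (f p) := fun p => by
    have : φ.comp inY = ψ.comp f := algHom_ext (fun ij => by simp [φ, inY])
    exact DFunLike.congr_fun this p
  have hφT : φ T = t := by simp [φ, T]
  let F : N → MvPolynomial ((N ⊕ N) ⊕ Unit) k := fun ij => ∑ l, inX (X (ij.1, l)) *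
    (inY ((Matrix.mvPolynomialX (Fin n) (Fin n) k).adjugate l ij.2) * T)
  let e : MvPolynomial ((N ⊕ N) ⊕ Unit) k :=
    inX (detPoly k n) * (inX (detPoly k n) * T * aeval F q - 1)
  have he : φ e = 0 := by
    refine algHom_eq_zero_of_zeros φ (S := inX '' idealOf M ∪ inY '' idealOf M ∪
      {T * inY (detPoly k n) - 1} ∪
      Set.range fun i => inX (orbitCoord P v i) - inY (orbitCoord P v i)) ?_ ?_
    · rintro s (((⟨p, hp, rfl⟩ | ⟨p, hp, rfl⟩) | rfl) | ⟨i, rfl⟩)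
      · rw [hφX, (hj p).2 hp]
      · rw [hφY, hf, Ideal.Quotient.eq_zero_iff_mem.2 hp, map_zero, map_zero]
      · rw [map_sub, map_mul, hφT, hφY, map_one, hf, ← map_mul, mul_comm,
          IsLocalization.Away.mul_invSelf δ, map_one, sub_self]
      · rw [map_sub, hφX, hφY, hψ _ ⟨i, rfl⟩, sub_self]
    · intro y hy
      let x' : Mat k n := Matrix.of fun a c => y (Sum.inl (Sum.inl (a, c)))
      let y' : Mat k n := Matrix.of fun a c => y (Sum.inl (Sum.inr (a, c)))
      let t' : k := y (Sum.inr ())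
      have hyX : ∀ p, aeval y (inX p) = mEval x' p := fun p => by
        rw [mEval_eq_aeval, aeval_rename]
        rfl
      have hyY : ∀ p, aeval y (inY p) = mEval y' p := fun p => by
        rw [mEval_eq_aeval, aeval_rename]
        rfl
      have hyT : aeval y T = t' := aeval_X _ _
      have hx' : x' ∈ M := hM.zclosed.mem_of_vanishing fun p hp => by
        rw [← hyX]
        exact hy _ (Or.inl (Or.inl (Or.inl ⟨p, hp, rfl⟩)))
      have hy' : y' ∈ M := hM.zclosed.mem_of_vanishing fun p hp => by
        rw [← hyY]
        exact hy _ (Or.inl (Or.inl (Or.inr ⟨p, hp, rfl⟩)))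
      have ht' : t' * y'.det = 1 := by
        have := hy _ (Or.inl (Or.inr rfl))
        rwa [map_sub, map_mul, hyT, hyY, mEval_detPoly, map_one, sub_eq_zero] at this
      have hxy : ∀ i, mEval x' (orbitCoord P v i) = mEval y' (orbitCoord P v i) := fun i => by
        have := hy _ (Or.inr ⟨i, rfl⟩)
        rwa [map_sub, hyX, hyY, sub_eq_zero] at this
      have hydet : y'.det ≠ 0 := right_ne_zero_of_mul_eq_one ht'
      have hyinv : y'⁻¹ = t' • y'.adjugate := by
        rw [Matrix.inv_def, Ring.inverse_eq_inv', eq_inv_of_mul_eq_one_left ht']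
      have hF : aeval y (aeval F q) = mEval (x' * y'⁻¹) q := by
        rw [mEval_eq_aeval, ← AlgHom.comp_apply, comp_aeval]
        congr 2
        ext ij
        have hadj : ∀ l, mEval y' ((Matrix.mvPolynomialX (Fin n) (Fin n) k).adjugate l ij.2) =
            y'.adjugate l ij.2 := fun l => by
          have h1 : (Matrix.mvPolynomialX (Fin n) (Fin n) k).map (mEval y') = y' := by
            ext a c
            simp [mEval]
          have := mEval_adjugate (Matrix.mvPolynomialX (Fin n) (Fin n) k) y'
          rw [h1] at this
          exact congrFun (congrFun this l) ij.2
        simp only [F, map_sum, map_mul, hyX, hyY, hyT, hyinv, hadj, Matrix.mul_apply,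
          Matrix.smul_apply, smul_eq_mul]
        refine Finset.sum_congr rfl fun l _ => ?_
        rw [mul_comm t']
        simp [mEval]
      simp only [e, map_mul, map_sub, map_one, hyX, hyT, hF, mEval_detPoly]
      by_cases hx'0 : x'.det = 0
      · rw [hx'0, zero_mul]
      have hg : x' * y'⁻¹ ∈ unitGroup M := (mem_unitGroup_iff hM).2
        ⟨hM.mul_mem _ hx' _ (hM.inv_mem hy' hydet), by
          simp [hx'0, hydet, Matrix.det_nonsing_inv]⟩
      have := hq _ ⟨hg, hP.vecMul_mul_inv hM hx' hy' hydet hxy⟩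
      rw [Matrix.det_mul, Matrix.det_nonsing_inv, Ring.inverse_eq_inv',
        ← eq_inv_of_mul_eq_one_left ht'] at this
      rw [this, sub_self, mul_zero]
  have hjdet : j (detPoly k n) ≠ 0 := fun h => hM.not_vanishesOn_detPoly ((hj _).1 h)
  have h1 := (mul_eq_zero.1 ((map_mul φ _ _).symm.trans he)).resolve_left (by rwa [hφX])
  rw [map_sub, map_mul, map_mul, hφX, map_one, sub_eq_zero] at h1
  have h2 := congrArg Θ h1
  rw [map_mul, map_mul, hΘ, mEval_detPoly, Matrix.det_mul, hx0] at h2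
  simp at h2

theorem IsRightRep.fixed_subset [IsAlgClosed k] {M : Set (Mat k n)} (hM : IsAlgMonoid M)
    (hMirr : IrreducibleSet M) {d : ℕ} {P : Matrix (Fin d) (Fin d) (MPoly k n)}
    (hP : IsRightRep M P) {v : Fin d → k}
    (hcl : ZClosed {g ∈ unitGroup M | Matrix.vecMul v (repApply P g) = v}) :
    {x ∈ M | Matrix.vecMul v (repApply P x) = v} =
      {g ∈ unitGroup M | Matrix.vecMul v (repApply P g) = v} := by
  ext x
  exact ⟨fun h => ⟨(mem_unitGroup_iff hM).2 ⟨h.1, hP.det_ne_zero_of_fixed hM hMirr hcl h.1 h.2⟩,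
    h.2⟩, fun h => ⟨h.1.1, h.2⟩⟩

/-- A closed stabilizer of a vector in a right module is observable. -/
theorem IsRightRep.leftObservable [IsAlgClosed k] {M : Set (Mat k n)} (hM : IsAlgMonoid M)
    (hMirr : IrreducibleSet M) {d : ℕ} {P : Matrix (Fin d) (Fin d) (MPoly k n)}
    (hP : IsRightRep M P) {v : Fin d → k}
    (hcl : ZClosed {g ∈ unitGroup M | Matrix.vecMul v (repApply P g) = v}) :
    LeftObservable {g ∈ unitGroup M | Matrix.vecMul v (repApply P g) = v} M := by
  intro J hMJ hJ ⟨f, hfJ, hfM⟩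
  by_contra! hno
  obtain ⟨b, hb, hbM, H⟩ := exists_specialization_of_irreducible hMirr (Ideal.Quotient.mkₐ k J)
    (fun p hp => Ideal.Quotient.eq_zero_iff_mem.2 (hMJ p hp)) (Set.range (orbitCoord P v))
    (fun p hp hp0 => by
      by_contra hpM
      obtain ⟨h, hh, m, hm, hne⟩ := hno p (Ideal.Quotient.eq_zero_iff_mem.1 hp0) hpM
      refine hne (mEval_eq_of_mem_adjoin ?_ hp)
      rintro _ ⟨i, rfl⟩
      rw [mEval_orbitCoord, mEval_orbitCoord, hP.vecMul_mul v hh.1.1 hm, hh.2])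
  obtain ⟨g, hg, hgb, hgf⟩ := hMirr.exists_ne_zero (p := b) (q := f * detPoly k n) hbM
    fun h => (hMirr.2 _ _ h).elim hfM hM.not_vanishesOn_detPoly
  rw [mEval_mul, mEval_detPoly] at hgf
  have hgdet := right_ne_zero_of_mul hgf
  obtain ⟨R, _, _, _, j, ψ, Θ, hj, hΘ, hψ⟩ := H g hg hgb
  let χ : MPoly k n →ₐ[k] k := (Θ.comp ψ).comp (Ideal.Quotient.mkₐ k J)
  let x : Mat k n := Matrix.of fun a c => χ (X (a, c))
  have hχ : ∀ p, χ p = mEval x p := fun p => by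
    rw [mEval_eq_aeval]
    exact DFunLike.congr_fun (algHom_ext (g := aeval fun ij : Fin n × Fin n => x ij.1 ij.2)
      fun ij => by simp [x]) p
  have hxJ : ∀ p ∈ J, mEval x p = 0 := fun p hp => by
    rw [← hχ]
    change Θ (ψ (Ideal.Quotient.mk J p)) = 0
    rw [Ideal.Quotient.eq_zero_iff_mem.2 hp, map_zero, map_zero]
  have hx : x ∈ M := hM.zclosed.mem_of_vanishing fun p hp => hxJ p (hMJ p hp)
  have hxg : ∀ i, mEval x (orbitCoord P v i) = mEval g (orbitCoord P v i) := fun i => by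
    rw [← hχ, ← hΘ, ← hψ _ ⟨i, rfl⟩]
    rfl
  have hgu : IsUnit g.det := isUnit_iff_ne_zero.2 hgdet
  have hg' := hM.inv_mem hg hgdet
  have hfix := hP.vecMul_mul_inv hM hx hg hgdet hxg
  have hdet := hP.det_ne_zero_of_fixed hM hMirr hcl (hM.mul_mem _ hx _ hg') hfix
  have hxdet : x.det ≠ 0 := fun h => hdet (by rw [Matrix.det_mul, h, zero_mul])
  have hxu : IsUnit x.det := isUnit_iff_ne_zero.2 hxdet
  have hgx : g * x⁻¹ ∈ unitGroup M := (mem_unitGroup_iff hM).2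
    ⟨hM.mul_mem _ hg _ (hM.inv_mem hx hxdet), by simp [hgdet, hxdet, Matrix.det_nonsing_inv]⟩
  obtain ⟨f', hf', hff'⟩ := hJ f hfJ (g * x⁻¹)
    ⟨hgx, hP.vecMul_mul_inv hM hg hx hxdet fun i => (hxg i).symm⟩
  have := hff' x hx
  rw [hxJ f' hf', mul_assoc, Matrix.nonsing_inv_mul _ hxu, mul_one] at this
  exact left_ne_zero_of_mul hgf this.symm

/-- Let `M` be an irreducible affine algebraic monoid with unit group
`G` and let `H ⊆ G` be a subgroup, closed in `M`.  Then `H` is observable in `M` iff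
there is a finite dimensional rational right `M`-module `V` and a vector `v ∈ V` whose
`G`-stabilizer is exactly `H`.  Moreover, in that case `G_v = M_v` and this set is
closed in `M`. -/
theorem observable_in_monoid_iff_stabilizer
    {k : Type} [Field k] [IsAlgClosed k] {n : ℕ}
    (M H : Set (Mat k n)) (hM : IsAlgMonoid M) (hMirr : IrreducibleSet M)
    (hH : IsSubgroupOf H (unitGroup M)) (hHcl : IsClosedIn H M) :
    (LeftObservable H M ↔
      ∃ (d : ℕ) (P : Matrix (Fin d) (Fin d) (MPoly k n)) (v : Fin d → k),
        IsRightRep M P ∧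
        {g ∈ unitGroup M | Matrix.vecMul v (repApply P g) = v} = H) ∧
    (∀ (d : ℕ) (P : Matrix (Fin d) (Fin d) (MPoly k n)) (v : Fin d → k),
      IsRightRep M P →
      {g ∈ unitGroup M | Matrix.vecMul v (repApply P g) = v} = H →
      ({x ∈ M | Matrix.vecMul v (repApply P x) = v} = H ∧
        IsClosedIn {x ∈ M | Matrix.vecMul v (repApply P x) = v} M)) := by
  have hcl : ∀ (d : ℕ) (P : Matrix (Fin d) (Fin d) (MPoly k n)) (v : Fin d → k),
      {g ∈ unitGroup M | Matrix.vecMul v (repApply P g) = v} = H →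
      ZClosed {g ∈ unitGroup M | Matrix.vecMul v (repApply P g) = v} := fun d P v h =>
    h.symm ▸ hHcl.zclosed hM.zclosed
  refine ⟨⟨fun h => h.exists_stabilizer hM hMirr hH hHcl, ?_⟩, fun d P v hP h => ?_⟩
  · rintro ⟨d, P, v, hP, h⟩
    have := hP.leftObservable hM hMirr (hcl d P v h)
    rwa [h] at this
  · have := (hP.fixed_subset hM hMirr (hcl d P v h)).trans h
    exact ⟨this, this.symm ▸ hHcl⟩

end AlgebraicMonoid
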